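/- arXiv:2005.10365 — 16 statements merged into one kernel-verified Lean document; each statement's English description precedes it below -/
import Mathlib

section
/- Let A be a reduced commutative ring with identity 1 ≠ 0 and let P be a weakly 1-absorbing prime ideal of A. Then the radical √P of P is a weakly prime ideal of A. -/
/-- A proper ideal `P` is weakly 1-absorbing prime if whenever `0 ≠ x*y*z ∈ P` for
nonunits `x, y, z`, then `x*y ∈ P` or `z ∈ P`. -/
def IsWeakly1AbsorbingPrime {A : Type*} [CommRing A] (P : Ideal A) : Prop :=
  P ≠ ⊤ ∧ ∀ x y z : A, ¬IsUnit x → ¬IsUnit y → ¬IsUnit z →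
    x * y * z ≠ 0 → x * y * z ∈ P → x * y ∈ P ∨ z ∈ P

/-- A proper ideal `P` is weakly prime if whenever `0 ≠ x*y ∈ P`, then `x ∈ P` or `y ∈ P`. -/
def IsWeaklyPrime {A : Type*} [CommRing A] (P : Ideal A) : Prop :=
  P ≠ ⊤ ∧ ∀ x y : A, x * y ≠ 0 → x * y ∈ P → x ∈ P ∨ y ∈ P

theorem radical_isWeaklyPrime_of_isWeakly1AbsorbingPrime {A : Type*} [CommRing A] [Nontrivial A]
    [IsReduced A] (P : Ideal A) (hP : IsWeakly1AbsorbingPrime P) :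
    IsWeaklyPrime P.radical := by
  obtain ⟨hne, habs⟩ := hP
  refine ⟨fun h => hne (Ideal.radical_eq_top.mp h), fun x y hxy hmem => ?_⟩
  by_cases hx : IsUnit x
  · exact Or.inr ((Ideal.unit_mul_mem_iff_mem _ hx).mp hmem)
  by_cases hy : IsUnit y
  · exact Or.inl ((Ideal.mul_unit_mem_iff_mem _ hy).mp hmem)
  obtain ⟨n, hn⟩ := hmem
  have hpow : x * x ^ (n + 1) * y ^ (n + 2) = (x * y) ^ (n + 2) := by ring
  have hprod := habs x (x ^ (n + 1)) (y ^ (n + 2)) hx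
    (by rwa [isUnit_pow_iff n.succ_ne_zero])
    (by rwa [isUnit_pow_iff (n + 1).succ_ne_zero])
    (hpow ▸ pow_ne_zero _ hxy)
    (hpow ▸ P.pow_mem_of_pow_mem hn (Nat.le_add_right n 2))
  exact hprod.imp (fun h => ⟨n + 2, by rwa [pow_succ']⟩) (fun h => ⟨n + 2, h⟩)
end

section
/- Let A be a reduced commutative ring with identity 1 ≠ 0, let P be a weakly 1-absorbing prime ideal of A, and let x ∈ A be a regular element (non-zero-divisor) that is neither a unit nor an element of P. Then the ideal quotient (P : x) = {a ∈ A : a·x ∈ P} is a weakly prime ideal of A. -/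
theorem colon_isWeaklyPrime_of_isWeakly1AbsorbingPrime {A : Type*} [CommRing A] [Nontrivial A]
    [IsReduced A] (P : Ideal A) (hP : IsWeakly1AbsorbingPrime P) (x : A)
    (hreg : x ∈ nonZeroDivisors A) (hxu : ¬IsUnit x) (hxP : x ∉ P) :
    IsWeaklyPrime (P.colon (Ideal.span {x})) := by
  have mem_colon (a : A) : a ∈ P.colon (Ideal.span {x}) ↔ a * x ∈ P := by
    simp
  refine ⟨fun h ↦ hxP ?_, fun a b hab habP ↦ ?_⟩
  · simpa using (mem_colon 1).1 (h ▸ Submodule.mem_top)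
  rw [mem_colon] at habP
  rw [mem_colon, mem_colon]
  by_cases ha : IsUnit a
  · rw [mul_assoc] at habP
    exact Or.inr ((Ideal.unit_mul_mem_iff_mem P ha).1 habP)
  by_cases hb : IsUnit b
  · rw [mul_comm a b, mul_assoc] at habP
    exact Or.inl ((Ideal.unit_mul_mem_iff_mem P hb).1 habP)
  have hperm : a * x * b = a * b * x := mul_right_comm a x b
  refine (hP.2 a x b ha hxu hb ?_ (hperm ▸ habP)).imp_right (P.mul_mem_right x)
  rw [hperm]
  exact fun h ↦ hab ((mul_right_mem_nonZeroDivisors_eq_zero_iff hreg).1 h)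
end

section
/- Let A₁ and A₂ be commutative rings with identity 1 ≠ 0 and let f : A₁ → A₂ be an injective unital ring homomorphism such that f(x) is a nonunit in A₂ for every nonunit x ∈ A₁. If P is a weakly 1-absorbing prime ideal of A₂, then f⁻¹(P) is a weakly 1-absorbing prime ideal of A₁. -/
theorem comap_isWeakly1AbsorbingPrime {A₁ A₂ : Type*} [CommRing A₁] [CommRing A₂]
    [Nontrivial A₁] [Nontrivial A₂] (f : A₁ →+* A₂) (hinj : Function.Injective f)
    (hu : ∀ x : A₁, ¬IsUnit x → ¬IsUnit (f x))
    (P : Ideal A₂) (hP : IsWeakly1AbsorbingPrime P) :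
    IsWeakly1AbsorbingPrime (P.comap f) := by
  refine ⟨Ideal.comap_ne_top f hP.1, fun x y z hx hy hz h0 hmem => ?_⟩
  simp only [Ideal.mem_comap, map_mul] at hmem ⊢
  refine hP.2 _ _ _ (hu x hx) (hu y hy) (hu z hz) ?_ hmem
  rwa [← map_mul, ← map_mul, map_ne_zero_iff f hinj]
end

section
/- Let A₁ and A₂ be commutative rings with identity 1 ≠ 0 and let f : A₁ → A₂ be a surjective unital ring homomorphism. If P* is a weakly 1-absorbing prime ideal of A₁ with ker(f) ⊆ P*, then f(P*) is a weakly 1-absorbing prime ideal of A₂. -/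
theorem Ideal.apply_mem_map_iff_of_surjective_of_ker_le {A₁ A₂ : Type*} [CommRing A₁]
    [CommRing A₂] {f : A₁ →+* A₂} (hsurj : Function.Surjective f) {P : Ideal A₁}
    (hker : RingHom.ker f ≤ P) {a : A₁} : f a ∈ P.map f ↔ a ∈ P := by
  rw [← Ideal.mem_comap, Ideal.comap_map_of_surjective' f hsurj, sup_eq_left.mpr hker]

theorem map_isWeakly1AbsorbingPrime {A₁ A₂ : Type*} [CommRing A₁] [CommRing A₂]
    [Nontrivial A₁] [Nontrivial A₂] (f : A₁ →+* A₂) (hsurj : Function.Surjective f)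
    (P : Ideal A₁) (hker : RingHom.ker f ≤ P) (hP : IsWeakly1AbsorbingPrime P) :
    IsWeakly1AbsorbingPrime (P.map f) := by
  have hmem {a : A₁} : f a ∈ P.map f ↔ a ∈ P :=
    Ideal.apply_mem_map_iff_of_surjective_of_ker_le hsurj hker
  refine ⟨fun htop => hP.1 ?_, fun x y z hx hy hz hne hxyz => ?_⟩
  · rw [Ideal.eq_top_iff_one, ← hmem, htop]
    exact Submodule.mem_top
  · obtain ⟨a, rfl⟩ := hsurj x
    obtain ⟨b, rfl⟩ := hsurj y
    obtain ⟨c, rfl⟩ := hsurj z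
    simp only [← map_mul, hmem] at hne hxyz ⊢
    exact hP.2 a b c (mt (·.map f) hx) (mt (·.map f) hy) (mt (·.map f) hz)
      (fun h => hne (by rw [h, map_zero])) hxyz
end

section
/- Let A be a commutative ring with identity 1 ≠ 0 and let Q ⊆ P be two ideals of A. If P is a weakly 1-absorbing prime ideal of A, then the image P/Q of P in the quotient ring A/Q is a weakly 1-absorbing prime ideal of A/Q. -/
theorem quotient_map_isWeakly1AbsorbingPrime {A : Type*} [CommRing A] [Nontrivial A]
    (Q P : Ideal A) (hQP : Q ≤ P) (hP : IsWeakly1AbsorbingPrime P) :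
    IsWeakly1AbsorbingPrime (P.map (Ideal.Quotient.mk Q)) := by
  have mem_map (a : A) : Ideal.Quotient.mk Q a ∈ P.map (Ideal.Quotient.mk Q) ↔ a ∈ P := by
    rw [← Ideal.mem_comap, Ideal.comap_map_of_surjective _ Ideal.Quotient.mk_surjective,
      ← RingHom.ker_eq_comap_bot, Ideal.mk_ker, sup_eq_left.mpr hQP]
  obtain ⟨hne, hP⟩ := hP
  refine ⟨fun h => hne ?_, fun x y z hx hy hz h0 hmem => ?_⟩
  · rw [Ideal.eq_top_iff_one] at h ⊢
    exact (mem_map 1).mp (by rwa [map_one])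
  · obtain ⟨a, rfl⟩ := Ideal.Quotient.mk_surjective x
    obtain ⟨b, rfl⟩ := Ideal.Quotient.mk_surjective y
    obtain ⟨c, rfl⟩ := Ideal.Quotient.mk_surjective z
    simp only [← map_mul, mem_map] at h0 hmem ⊢
    exact hP a b c (fun h => hx (h.map _)) (fun h => hy (h.map _)) (fun h => hz (h.map _))
      (fun h => h0 (by rw [h, map_zero])) hmem
end

section
/- Let A be a commutative ring with identity 1 ≠ 0, let S ⊆ A be a multiplicatively closed set, and let P be a weakly 1-absorbing prime ideal of A with P ∩ S = ∅. Then the extension S⁻¹P of P to the localization S⁻¹A is a weakly 1-absorbing prime ideal of S⁻¹A. -/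
theorem not_isUnit_of_not_isUnit_mk' {A B : Type*} [CommRing A] [CommRing B] [Algebra A B]
    {S : Submonoid A} [IsLocalization S B] {r : A} {w : S}
    (h : ¬IsUnit (IsLocalization.mk' B r w)) : ¬IsUnit r := fun hr =>
  h <| isUnit_of_mul_isUnit_left (y := algebraMap A B w) <| by
    rw [IsLocalization.mk'_spec]
    exact hr.map _

theorem localization_map_isWeakly1AbsorbingPrime {A : Type*} [CommRing A] [Nontrivial A]
    (S : Submonoid A) (P : Ideal A) (hP : IsWeakly1AbsorbingPrime P)
    (hdisj : Disjoint (S : Set A) (P : Set A)) :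
    IsWeakly1AbsorbingPrime (P.map (algebraMap A (Localization S))) := by
  refine ⟨(IsLocalization.map_algebraMap_ne_top_iff_disjoint S _ P).2 hdisj, ?_⟩
  intro x y z hx hy hz hne hmem
  obtain ⟨a, s, rfl⟩ := IsLocalization.exists_mk'_eq S x
  obtain ⟨b, t, rfl⟩ := IsLocalization.exists_mk'_eq S y
  obtain ⟨c, u, rfl⟩ := IsLocalization.exists_mk'_eq S z
  simp only [← IsLocalization.mk'_mul, ne_eq, IsLocalization.mk'_eq_zero_iff, not_exists,
    IsLocalization.mk'_mem_map_algebraMap_iff] at hne hmem ⊢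
  obtain ⟨v, hv, hvP⟩ := hmem
  have hassoc : v * a * b * c = v * (a * b * c) := by ring
  rcases hP.2 (v * a) b c
    (fun h => not_isUnit_of_not_isUnit_mk' hx (isUnit_of_mul_isUnit_right h))
    (not_isUnit_of_not_isUnit_mk' hy) (not_isUnit_of_not_isUnit_mk' hz)
    (hassoc ▸ hne ⟨v, hv⟩) (hassoc ▸ hvP) with h | h
  · exact Or.inl ⟨v, hv, mul_assoc v a b ▸ h⟩
  · exact Or.inr ⟨1, S.one_mem, (one_mul c).symm ▸ h⟩
end

section
/- Let A be a commutative ring with identity 1 ≠ 0 that has at least two distinct maximal ideals, and let P be a proper ideal of A such that for every x ∈ P the annihilator ann(x) = {a ∈ A : a·x = 0} is not a maximal ideal of A. Then P is a weakly prime ideal of A if and only if P is a weakly 1-absorbing prime ideal of A. -/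
/-- A ring with two distinct maximal ideals has two nonunits whose sum is `1`. -/
theorem exists_nonunits_add_eq_one {A : Type*} [CommRing A] {m₁ m₂ : Ideal A}
    (h₁ : m₁.IsMaximal) (h₂ : m₂.IsMaximal) (hne : m₁ ≠ m₂) :
    ∃ a b : A, ¬IsUnit a ∧ ¬IsUnit b ∧ a + b = 1 := by
  obtain ⟨a, ha, b, hb, hab⟩ := Submodule.mem_sup.1
    ((Ideal.eq_top_iff_one _).1 (h₁.coprime_of_ne h₂ hne))
  exact ⟨a, b, fun h => h₁.ne_top (Ideal.eq_top_of_isUnit_mem _ ha h),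
    fun h => h₂.ne_top (Ideal.eq_top_of_isUnit_mem _ hb h), hab⟩

theorem IsWeaklyPrime.isWeakly1AbsorbingPrime {A : Type*} [CommRing A] {P : Ideal A}
    (h : IsWeaklyPrime P) : IsWeakly1AbsorbingPrime P :=
  ⟨h.1, fun x y z _ _ _ h0 hmem => h.2 (x * y) z h0 hmem⟩

/-- If `x * y` is a nonzero element of a weakly 1-absorbing prime ideal `P` whose annihilator is
not maximal, and `x`, `y` are nonunits with `y ∉ P`, then every nonunit multiplies `x` into `P`. -/
theorem IsWeakly1AbsorbingPrime.mul_mem_of_not_isUnit {A : Type*} [CommRing A] {P : Ideal A}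
    (h : IsWeakly1AbsorbingPrime P) {x y : A} (hx : ¬IsUnit x) (hy : ¬IsUnit y)
    (h0 : x * y ≠ 0) (hmem : x * y ∈ P) (hyP : y ∉ P)
    (hann : ¬((⊥ : Ideal A).colon (Ideal.span {x * y})).IsMaximal)
    {w : A} (hw : ¬IsUnit w) : w * x ∈ P := by
  have mul_mem_of_ne_zero : ∀ v : A, ¬IsUnit v → v * (x * y) ≠ 0 → v * x ∈ P := by
    intro v hv hv0
    refine (h.2 v x y hv hx hy ?_ ?_).resolve_right hyP
    · rwa [mul_assoc]
    · rw [mul_assoc]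
      exact P.mul_mem_left v hmem
  by_cases hw0 : w * (x * y) = 0
  swap
  · exact mul_mem_of_ne_zero w hw hw0
  set I := (⊥ : Ideal A).colon (Ideal.span {x * y}) with hI
  have mem_I : ∀ v : A, v ∈ I ↔ v * (x * y) = 0 := by
    intro v
    simp [hI]
  have hI_top : I ≠ ⊤ := by
    rw [Ideal.ne_top_iff_one, mem_I, one_mul]
    exact h0
  obtain ⟨M, hM, hIM⟩ := Ideal.exists_le_maximal I hI_top
  obtain ⟨a, haM, haI⟩ := SetLike.exists_of_lt (lt_of_le_of_ne hIM fun e => hann (e ▸ hM))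
  have not_isUnit_of_mem : ∀ v ∈ M, ¬IsUnit v := fun v hv hu =>
    hM.ne_top (Ideal.eq_top_of_isUnit_mem _ hv hu)
  rw [mem_I] at haI
  have hax := mul_mem_of_ne_zero a (not_isUnit_of_mem a haM) haI
  have hwax := mul_mem_of_ne_zero (w + a)
    (not_isUnit_of_mem _ (M.add_mem (hIM ((mem_I w).2 hw0)) haM))
    (by rwa [add_mul, hw0, zero_add])
  rw [add_mul] at hwax
  exact (P.add_mem_iff_left hax).1 hwax

theorem isWeaklyPrime_iff_isWeakly1AbsorbingPrime {A : Type*} [CommRing A] [Nontrivial A]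
    (hnl : ∃ m₁ m₂ : Ideal A, m₁.IsMaximal ∧ m₂.IsMaximal ∧ m₁ ≠ m₂)
    (P : Ideal A) (hP : P ≠ ⊤)
    (hann : ∀ x ∈ P, ¬((⊥ : Ideal A).colon (Ideal.span {x})).IsMaximal) :
    IsWeaklyPrime P ↔ IsWeakly1AbsorbingPrime P := by
  refine ⟨IsWeaklyPrime.isWeakly1AbsorbingPrime, fun h => ⟨hP, fun x y h0 hmem => ?_⟩⟩
  by_cases hx : IsUnit x
  · exact Or.inr ((Ideal.unit_mul_mem_iff_mem P hx).1 hmem)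
  by_cases hy : IsUnit y
  · exact Or.inl ((Ideal.mul_unit_mem_iff_mem P hy).1 hmem)
  refine or_iff_not_imp_right.2 fun hyP => ?_
  obtain ⟨m₁, m₂, h₁, h₂, hne⟩ := hnl
  obtain ⟨a, b, ha, hb, hab⟩ := exists_nonunits_add_eq_one h₁ h₂ hne
  have mul_mem {w : A} (hw : ¬IsUnit w) : w * x ∈ P :=
    h.mul_mem_of_not_isUnit hx hy h0 hmem hyP (hann _ hmem) hw
  simpa [← add_mul, hab] using P.add_mem (mul_mem ha) (mul_mem hb)
end

section
/- Let A be a commutative ring with identity 1 ≠ 0 and P a proper ideal of A. Then P is a weakly 1-absorbing prime ideal of A if and only if for all nonunits x, y ∈ A with xy ∉ P, either (P : xy) = P or (P : xy) = (0 : xy), where (I : a) = {b ∈ A : a·b ∈ I}. -/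
theorem Ideal.mem_colon_span_singleton_iff_mul_mem {A : Type*} [CommRing A] (I : Ideal A)
    (a b : A) : b ∈ I.colon (Ideal.span {a} : Set A) ↔ a * b ∈ I := by
  rw [Submodule.colon_span, Submodule.mem_colon_singleton, smul_eq_mul, mul_comm]

theorem isWeakly1AbsorbingPrime_iff_colon {A : Type*} [CommRing A] [Nontrivial A]
    (P : Ideal A) (hP : P ≠ ⊤) :
    IsWeakly1AbsorbingPrime P ↔
      ∀ x y : A, ¬IsUnit x → ¬IsUnit y → x * y ∉ P →
        P.colon (Ideal.span {x * y}) = P ∨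
        P.colon (Ideal.span {x * y}) = (⊥ : Ideal A).colon (Ideal.span {x * y}) := by
  constructor
  · rintro ⟨-, h⟩ x y hx hy hxy
    have le_colon : P ≤ P.colon (Ideal.span {x * y} : Set A) := fun b hb =>
      (Ideal.mem_colon_span_singleton_iff_mul_mem _ _ _).2 (P.mul_mem_left _ hb)
    have bot_colon_le : (⊥ : Ideal A).colon (Ideal.span {x * y} : Set A) ≤
        P.colon (Ideal.span {x * y} : Set A) := Submodule.colon_mono bot_le subset_rfl
    have colon_subset : (P.colon (Ideal.span {x * y} : Set A) : Set A) ⊆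
        P ∪ ((⊥ : Ideal A).colon (Ideal.span {x * y} : Set A) : Set A) := by
      intro b hb
      have hb' : x * y * b ∈ P := (Ideal.mem_colon_span_singleton_iff_mul_mem _ _ _).1 hb
      by_cases h0 : x * y * b = 0
      · exact Or.inr ((Ideal.mem_colon_span_singleton_iff_mul_mem _ _ _).2 h0)
      · have hbu : ¬IsUnit b := fun hu => hxy ((Ideal.mul_unit_mem_iff_mem P hu).1 hb')
        exact Or.inl ((h x y b hx hy hbu h0 hb').resolve_left hxy)
    exact (Ideal.subset_union.1 colon_subset).imp
      (fun hle => le_antisymm hle le_colon) (fun hle => le_antisymm hle bot_colon_le)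
  · refine fun h => ⟨hP, fun x y z hx hy _ h0 hmem => ?_⟩
    by_cases hxy : x * y ∈ P
    · exact Or.inl hxy
    · have hz := (Ideal.mem_colon_span_singleton_iff_mul_mem P (x * y) z).2 hmem
      rcases h x y hx hy hxy with heq | heq
      · exact Or.inr (heq ▸ hz)
      · rw [heq, Ideal.mem_colon_span_singleton_iff_mul_mem] at hz
        exact absurd hz h0
end

section
/- Let A be a commutative ring with identity 1 ≠ 0 and P a proper ideal of A. Then P is a weakly 1-absorbing prime ideal of A if and only if for all proper ideals I, J, K of A with 0 ≠ IJK ⊆ P (i.e., the product IJK is nonzero and contained in P), either IJ ⊆ P or K ⊆ P. -/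
/-- If `P` is weakly 1-absorbing prime, `I * J * K ≤ P` and `K ≰ P`, then `K` annihilates every
product `a * b ∉ P` with `a ∈ I` and `b ∈ J`. -/
lemma IsWeakly1AbsorbingPrime.mul_mul_eq_zero_of_notMem {A : Type*} [CommRing A] {P : Ideal A}
    (h : IsWeakly1AbsorbingPrime P) {I J K : Ideal A} (hI : I ≠ ⊤) (hJ : J ≠ ⊤) (hK : K ≠ ⊤)
    (hle : I * J * K ≤ P) (hKP : ¬K ≤ P) {a b c : A} (ha : a ∈ I) (hb : b ∈ J)
    (hab : a * b ∉ P) (hc : c ∈ K) : a * b * c = 0 := by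
  have nonunit {L : Ideal A} (hL : L ≠ ⊤) {x : A} (hx : x ∈ L) : ¬IsUnit x :=
    fun hu => hL (L.eq_top_of_isUnit_mem hx hu)
  have key {c : A} (hc : c ∈ K) (hcP : c ∉ P) : a * b * c = 0 := by
    by_contra hne
    exact (h.2 a b c (nonunit hI ha) (nonunit hJ hb) (nonunit hK hc) hne
      (hle (Ideal.mul_mem_mul (Ideal.mul_mem_mul ha hb) hc))).elim hab hcP
  by_cases hcP : c ∈ P
  · obtain ⟨d, hd, hdP⟩ := SetLike.not_le_iff_exists.mp hKP
    have hcd := key (K.add_mem hc hd) (fun hm => hdP ((P.add_mem_iff_right hcP).mp hm))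
    rwa [mul_add, key hd hdP, add_zero] at hcd
  · exact key hc hcP

/-- If `P` is weakly 1-absorbing prime and `I * J * K ≤ P` with `I * J ≰ P` and `K ≰ P`, then
`I * J * K = ⊥`. -/
lemma IsWeakly1AbsorbingPrime.mul_mul_eq_bot {A : Type*} [CommRing A] {P : Ideal A}
    (h : IsWeakly1AbsorbingPrime P) {I J K : Ideal A} (hI : I ≠ ⊤) (hJ : J ≠ ⊤) (hK : K ≠ ⊤)
    (hle : I * J * K ≤ P) (hIJP : ¬I * J ≤ P) (hKP : ¬K ≤ P) : I * J * K = ⊥ := by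
  have key {a b c : A} (ha : a ∈ I) (hb : b ∈ J) (hc : c ∈ K) (hab : a * b ∉ P) :
      a * b * c = 0 :=
    h.mul_mul_eq_zero_of_notMem hI hJ hK hle hKP ha hb hab hc
  obtain ⟨a₀, ha₀, b₀, hb₀, hab₀⟩ : ∃ a ∈ I, ∃ b ∈ J, a * b ∉ P := by
    simpa [Ideal.mul_le] using hIJP
  have hleft {b c : A} (hb : b ∈ J) (hc : c ∈ K) : a₀ * b * c = 0 := by
    by_cases hP : a₀ * b ∈ P
    · have hsum := key ha₀ (J.add_mem hb hb₀) hc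
        (by rwa [mul_add, P.add_mem_iff_right hP])
      linear_combination hsum - key ha₀ hb₀ hc hab₀
    · exact key ha₀ hb hc hP
  have hright {a b c : A} (ha : a ∈ I) (hb : b ∈ J) (hc : c ∈ K) (hab : a₀ * b ∉ P) :
      a * b * c = 0 := by
    by_cases hP : a * b ∈ P
    · have hsum := key (I.add_mem ha ha₀) hb hc
        (by rwa [add_mul, P.add_mem_iff_right hP])
      linear_combination hsum - hleft hb hc
    · exact key ha hb hc hP
  rw [← le_bot_iff, Ideal.mul_le]
  intro r hr c hc
  rw [Ideal.mem_bot]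
  induction hr using Submodule.mul_induction_on' with
  | mem_mul_mem a ha b hb =>
    by_cases hP : a₀ * b ∈ P
    · have hsum := hright ha (J.add_mem hb hb₀) hc
        (by rwa [mul_add, P.add_mem_iff_right hP])
      linear_combination hsum - hright ha hb₀ hc hab₀
    · exact hright ha hb hc hP
  | add x _ y _ hx hy => rw [add_mul, hx, hy, add_zero]

theorem isWeakly1AbsorbingPrime_iff_ideal_triple {A : Type*} [CommRing A] [Nontrivial A]
    (P : Ideal A) (hP : P ≠ ⊤) :
    IsWeakly1AbsorbingPrime P ↔
      ∀ I J K : Ideal A, I ≠ ⊤ → J ≠ ⊤ → K ≠ ⊤ → I * J * K ≠ ⊥ → I * J * K ≤ P →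
        I * J ≤ P ∨ K ≤ P := by
  refine ⟨fun h I J K hI hJ hK hne hle => ?_, fun h => ⟨hP, fun x y z hx hy hz hne hmem => ?_⟩⟩
  · by_contra! hcon
    exact hne (h.mul_mul_eq_bot hI hJ hK hle hcon.1 hcon.2)
  · simpa [Ideal.span_singleton_mul_span_singleton, Ideal.span_singleton_le_iff_mem] using
      h (Ideal.span {x}) (Ideal.span {y}) (Ideal.span {z})
        (by rwa [Ne, Ideal.span_singleton_eq_top]) (by rwa [Ne, Ideal.span_singleton_eq_top])
        (by rwa [Ne, Ideal.span_singleton_eq_top])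
        (by simpa [Ideal.span_singleton_mul_span_singleton] using hne)
        (by simpa [Ideal.span_singleton_mul_span_singleton,
          Ideal.span_singleton_le_iff_mem] using hmem)
end

section
/- Let A be a commutative ring with identity 1 ≠ 0, let P be a weakly 1-absorbing prime ideal of A, and let (x, y, z) be a 1-triple zero of P. Then xyP = 0, that is, x·y·p = 0 for every p ∈ P. -/
theorem triple_zero_mul_eq_zero {A : Type*} [CommRing A] [Nontrivial A]
    (P : Ideal A) (hP : IsWeakly1AbsorbingPrime P) (x y z : A)
    (hx : ¬IsUnit x) (hy : ¬IsUnit y) (hz : ¬IsUnit z)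
    (h0 : x * y * z = 0) (hxy : x * y ∉ P) (hzP : z ∉ P) :
    ∀ p ∈ P, x * y * p = 0 := by
  intro p hp
  by_contra hne
  have hsum : x * y * (z + p) = x * y * p := by rw [mul_add, h0, zero_add]
  have hmem : x * y * (z + p) ∈ P := hsum ▸ P.mul_mem_left (x * y) hp
  have hu : ¬IsUnit (z + p) := fun hu => hxy ((P.mul_unit_mem_iff_mem hu).mp hmem)
  rcases hP.2 x y (z + p) hx hy hu (hsum ▸ hne) hmem with h | h
  · exact hxy h
  · exact hzP ((P.add_mem_iff_left hp).mp h)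
end

section
/- Let A be a commutative ring with identity 1 ≠ 0, let P be a weakly 1-absorbing prime ideal of A, and let (x, y, z) be a 1-triple zero of P such that xz ∉ P and yz ∉ P. Then xzP = yzP = xP² = yP² = zP² = 0, and in particular P³ = 0. -/
/-- If no product of two of the factors `a, b, c` lies in a weakly 1-absorbing prime ideal, then
`a * b * c` lies in the ideal only if it vanishes; the factors need not be nonunits. -/
theorem IsWeakly1AbsorbingPrime.mul_mul_eq_zero {A : Type*} [CommRing A] {P : Ideal A}
    (hP : IsWeakly1AbsorbingPrime P) {a b c : A} (hab : a * b ∉ P) (hac : a * c ∉ P)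
    (hbc : b * c ∉ P) (h : a * b * c ∈ P) : a * b * c = 0 := by
  by_contra hne
  have ha : ¬IsUnit a := fun hu =>
    hbc ((Ideal.unit_mul_mem_iff_mem P hu).1 (mul_assoc a b c ▸ h))
  have hb : ¬IsUnit b := fun hu =>
    hac ((Ideal.unit_mul_mem_iff_mem P hu).1 (by rwa [← mul_assoc, mul_comm b a]))
  have hc : ¬IsUnit c := fun hu => hab ((Ideal.mul_unit_mem_iff_mem P hu).1 h)
  exact (hP.2 a b c ha hb hc hne h).elim hab fun hcP => hac (P.mul_mem_left a hcP)

/-- Adding elements of an ideal to two factors preserves non-membership of their product. -/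
theorem Ideal.add_mul_add_notMem {A : Type*} [CommRing A] {P : Ideal A} {a b p q : A}
    (hp : p ∈ P) (hq : q ∈ P) (hab : a * b ∉ P) : (a + p) * (b + q) ∉ P := by
  rw [← Ideal.Quotient.eq_zero_iff_mem] at *
  simpa [hp, hq] using hab

theorem triple_zero_cube_eq_zero {A : Type*} [CommRing A] [Nontrivial A]
    (P : Ideal A) (hP : IsWeakly1AbsorbingPrime P) (x y z : A)
    (hx : ¬IsUnit x) (hy : ¬IsUnit y) (hz : ¬IsUnit z)
    (h0 : x * y * z = 0) (hxy : x * y ∉ P) (hzP : z ∉ P)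
    (hxz : x * z ∉ P) (hyz : y * z ∉ P) :
    (∀ p ∈ P, x * z * p = 0) ∧ (∀ p ∈ P, y * z * p = 0) ∧
    (∀ p ∈ P, ∀ q ∈ P, x * p * q = 0) ∧ (∀ p ∈ P, ∀ q ∈ P, y * p * q = 0) ∧
    (∀ p ∈ P, ∀ q ∈ P, z * p * q = 0) ∧
    (∀ p ∈ P, ∀ q ∈ P, ∀ r ∈ P, p * q * r = 0) := by
  have key : ∀ p ∈ P, ∀ q ∈ P, ∀ r ∈ P, (x + p) * (y + q) * (z + r) = 0 := by
    intro p hp q hq r hr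
    refine hP.mul_mul_eq_zero (Ideal.add_mul_add_notMem hp hq hxy)
      (Ideal.add_mul_add_notMem hp hr hxz) (Ideal.add_mul_add_notMem hq hr hyz) ?_
    have h0' := congrArg (Ideal.Quotient.mk P) h0
    rw [← Ideal.Quotient.eq_zero_iff_mem] at *
    simpa [hp, hq, hr] using h0'
  have zero_mem := P.zero_mem
  have xyP : ∀ p ∈ P, x * y * p = 0 := fun p hp => by
    linear_combination key 0 zero_mem 0 zero_mem p hp - h0
  have xzP : ∀ p ∈ P, x * z * p = 0 := fun p hp => by
    linear_combination key 0 zero_mem p hp 0 zero_mem - h0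
  have yzP : ∀ p ∈ P, y * z * p = 0 := fun p hp => by
    linear_combination key p hp 0 zero_mem 0 zero_mem - h0
  have xPP : ∀ p ∈ P, ∀ q ∈ P, x * p * q = 0 := fun p hp q hq => by
    linear_combination key 0 zero_mem p hp q hq - h0 - xyP q hq - xzP p hp
  have yPP : ∀ p ∈ P, ∀ q ∈ P, y * p * q = 0 := fun p hp q hq => by
    linear_combination key p hp 0 zero_mem q hq - h0 - xyP q hq - yzP p hp
  have zPP : ∀ p ∈ P, ∀ q ∈ P, z * p * q = 0 := fun p hp q hq => by
    linear_combination key p hp q hq 0 zero_mem - h0 - xzP q hq - yzP p hp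
  refine ⟨xzP, yzP, xPP, yPP, zPP, fun p hp q hq r hr => ?_⟩
  linear_combination key p hp q hq r hr - h0 - xyP r hr - xzP q hq - yzP p hp
    - xPP q hq r hr - yPP p hp r hr - zPP p hp q hq
end

section
/- Let A be a commutative ring with identity 1 ≠ 0, let M be an A-module, let P be a proper ideal of A, and consider the trivial extension A ⋉ M (the ring on A × M with componentwise addition and multiplication (x, m)(y, m') = (xy, xm' + ym)). Then the ideal P ⋉ M = {(x, m) : x ∈ P, m ∈ M} is a weakly 1-absorbing prime ideal of A ⋉ M if and only if P is a weakly 1-absorbing prime ideal of A and, whenever xyz = 0 for nonunits x, y, z ∈ A with xy ∉ P and z ∉ P, one has xy, xz, yz ∈ ann(M) = {a ∈ A : aM = 0}. -/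
theorem TrivSqZeroExt.snd_mul_mul {A M : Type*} [CommRing A] [AddCommGroup M] [Module A M]
    [Module Aᵐᵒᵖ M] [IsCentralScalar A M] (a b c : TrivSqZeroExt A M) :
    (a * b * c).snd =
      (a.fst * b.fst) • c.snd + (a.fst * c.fst) • b.snd + (b.fst * c.fst) • a.snd := by
  simp only [snd_mul, fst_mul, op_smul_eq_smul, smul_add, smul_smul]
  rw [mul_comm c.fst a.fst, mul_comm c.fst b.fst, add_assoc]

theorem trivSqZeroExt_isWeakly1AbsorbingPrime_iff {A M : Type*} [CommRing A] [Nontrivial A]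
    [AddCommGroup M] [Module A M] [Module Aᵐᵒᵖ M] [IsCentralScalar A M]
    (P : Ideal A) (hP : P ≠ ⊤) :
    IsWeakly1AbsorbingPrime (Ideal.comap (TrivSqZeroExt.fstHom A A M) P) ↔
      (IsWeakly1AbsorbingPrime P ∧
        ∀ x y z : A, ¬IsUnit x → ¬IsUnit y → ¬IsUnit z → x * y * z = 0 →
          x * y ∉ P → z ∉ P →
          (∀ m : M, (x * y) • m = 0) ∧ (∀ m : M, (x * z) • m = 0) ∧
          (∀ m : M, (y * z) • m = 0)) := by
  have isUnit_iff (a : TrivSqZeroExt A M) : IsUnit a ↔ IsUnit a.fst :=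
    TrivSqZeroExt.isUnit_iff_isUnit_fst
  have mem_iff (a : TrivSqZeroExt A M) :
      a ∈ Ideal.comap (TrivSqZeroExt.fstHom A A M) P ↔ a.fst ∈ P := Iff.rfl
  constructor
  · rintro ⟨-, h⟩
    -- The hypothesis, unfolded in components.
    have key (x y z : A) (hx : ¬IsUnit x) (hy : ¬IsUnit y) (hz : ¬IsUnit z)
        (hmem : x * y * z ∈ P) (hxy : x * y ∉ P) (hzP : z ∉ P) (m n k : M) :
        x * y * z = 0 ∧ (x * y) • k + (x * z) • n + (y * z) • m = 0 := by
      let a : TrivSqZeroExt A M := (x, m)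
      let b : TrivSqZeroExt A M := (y, n)
      let c : TrivSqZeroExt A M := (z, k)
      have habc : a * b * c = 0 := by
        by_contra hne
        exact (h a b c (mt (isUnit_iff a).1 hx) (mt (isUnit_iff b).1 hy)
          (mt (isUnit_iff c).1 hz) hne hmem).elim hxy hzP
      exact ⟨congrArg TrivSqZeroExt.fst habc,
        (TrivSqZeroExt.snd_mul_mul a b c).symm.trans (congrArg TrivSqZeroExt.snd habc)⟩
    refine ⟨⟨hP, fun x y z hx hy hz hne hmem => ?_⟩, fun x y z hx hy hz h0 hxy hzP => ?_⟩
    · by_contra! hcon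
      exact hne (key x y z hx hy hz hmem hcon.1 hcon.2 0 0 0).1
    · have hsmul := fun m n k => (key x y z hx hy hz (h0 ▸ P.zero_mem) hxy hzP m n k).2
      exact ⟨fun m => by simpa using hsmul 0 0 m, fun m => by simpa using hsmul 0 m 0,
        fun m => by simpa using hsmul m 0 0⟩
  · rintro ⟨⟨-, h⟩, hann⟩
    refine ⟨Ideal.comap_ne_top _ hP, fun a b c ha hb hc hne hmem => ?_⟩
    rw [isUnit_iff] at ha hb hc
    simp only [mem_iff, TrivSqZeroExt.fst_mul] at hmem ⊢
    by_cases h0 : a.fst * b.fst * c.fst = 0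
    · by_contra! hcon
      obtain ⟨hab, hac, hbc⟩ := hann _ _ _ ha hb hc h0 hcon.1 hcon.2
      refine hne (TrivSqZeroExt.ext h0 ?_)
      rw [TrivSqZeroExt.snd_mul_mul, hab, hac, hbc]
      simp
    · exact h _ _ _ ha hb hc h0 hmem
end

section
/- Let A₁ and A₂ be commutative rings with identity 1 ≠ 0 and let A = A₁ × A₂. Then every proper ideal of A is a weakly 1-absorbing prime ideal if and only if A₁ and A₂ are both fields. -/
/-- If every proper ideal is weakly 1-absorbing prime, apply this to the principal ideal
generated by `e * z`, with `e` a nonunit idempotent and `z` a nonunit. -/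
lemma IsIdempotentElem.mul_dvd_of_forall_isWeakly1AbsorbingPrime {A : Type*} [CommRing A]
    (h : ∀ P : Ideal A, P ≠ ⊤ → IsWeakly1AbsorbingPrime P) {e z : A}
    (he : IsIdempotentElem e) (heu : ¬IsUnit e) (hz : ¬IsUnit z) (hez : e * z ≠ 0) :
    e * z ∣ e ∨ e * z ∣ z := by
  have hP : Ideal.span {e * z} ≠ ⊤ := fun ht =>
    hz (isUnit_of_mul_isUnit_right (Ideal.span_singleton_eq_top.mp ht))
  have := (h _ hP).2 e e z heu heu hz
  rw [he.eq] at this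
  simpa only [Ideal.mem_span_singleton] using this hez (Ideal.mem_span_singleton_self _)

lemma mul_dvd_right_of_prod_isField {A₁ A₂ : Type*} [CommRing A₁] [CommRing A₂]
    (h₁ : IsField A₁) (h₂ : IsField A₂) {w z : A₁ × A₂} (hz : ¬IsUnit z) (hwz : w * z ≠ 0) :
    w * z ∣ z := by
  obtain ⟨w₁, w₂⟩ := w
  obtain ⟨z₁, z₂⟩ := z
  have isUnit₁ {a : A₁} (ha : a ≠ 0) : IsUnit a :=
    let ⟨b, hb⟩ := h₁.mul_inv_cancel ha
    .of_mul_eq_one b hb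
  have isUnit₂ {a : A₂} (ha : a ≠ 0) : IsUnit a :=
    let ⟨b, hb⟩ := h₂.mul_inv_cancel ha
    .of_mul_eq_one b hb
  rw [Prod.mk_mul_mk, prod_dvd_iff]
  simp only [Prod.isUnit_iff] at hz
  by_cases hz₁ : z₁ = 0
  · subst hz₁
    have hw₂ : w₂ ≠ 0 := by rintro rfl; simp at hwz
    exact ⟨dvd_zero _, (isUnit₂ hw₂).mul_left_dvd.mpr dvd_rfl⟩
  · have hz₂ : z₂ = 0 := by
      by_contra hz₂
      exact hz ⟨isUnit₁ hz₁, isUnit₂ hz₂⟩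
    subst hz₂
    have hw₁ : w₁ ≠ 0 := by rintro rfl; simp at hwz
    exact ⟨(isUnit₁ hw₁).mul_left_dvd.mpr dvd_rfl, dvd_zero _⟩

theorem prod_forall_isWeakly1AbsorbingPrime_iff_fields {A₁ A₂ : Type*} [CommRing A₁]
    [CommRing A₂] [Nontrivial A₁] [Nontrivial A₂] :
    (∀ P : Ideal (A₁ × A₂), P ≠ ⊤ → IsWeakly1AbsorbingPrime P) ↔
      (IsField A₁ ∧ IsField A₂) := by
  constructor
  · intro h
    refine ⟨⟨exists_pair_ne A₁, mul_comm, fun {a} ha => ?_⟩,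
      ⟨exists_pair_ne A₂, mul_comm, fun {a} ha => ?_⟩⟩
    · by_contra hu
      rw [← isUnit_iff_exists_inv] at hu
      have he : IsIdempotentElem ((1, 0) : A₁ × A₂) := by simp [IsIdempotentElem]
      have := he.mul_dvd_of_forall_isWeakly1AbsorbingPrime h (z := (a, 1))
        (by simp [Prod.isUnit_iff]) (by simp [Prod.isUnit_iff, hu]) (by simp [ha])
      simp [prod_dvd_iff, ← isUnit_iff_dvd_one, hu] at this
    · by_contra hu
      rw [← isUnit_iff_exists_inv] at hu
      have he : IsIdempotentElem ((0, 1) : A₁ × A₂) := by simp [IsIdempotentElem]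
      have := he.mul_dvd_of_forall_isWeakly1AbsorbingPrime h (z := (1, a))
        (by simp [Prod.isUnit_iff]) (by simp [Prod.isUnit_iff, hu]) (by simp [ha])
      simp [prod_dvd_iff, ← isUnit_iff_dvd_one, hu] at this
  · rintro ⟨h₁, h₂⟩ P hP
    exact ⟨hP, fun x y z _ _ hz hne hmem =>
      .inr (P.mem_of_dvd (mul_dvd_right_of_prod_isField h₁ h₂ hz hne) hmem)⟩
end

section
/- Let A be a commutative ring with identity 1 ≠ 0 in which every proper ideal is a weakly 1-absorbing prime ideal. Then A has at most two maximal ideals. -/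
/-- A maximal ideal is not covered by two other proper ideals. -/
theorem exists_mem_notMem_of_isMaximal {A : Type*} [CommRing A] {m n k : Ideal A}
    (hm : m.IsMaximal) (hn : n ≠ ⊤) (hk : k ≠ ⊤) (hmn : m ≠ n) (hmk : m ≠ k) :
    ∃ x ∈ m, x ∉ n ∧ x ∉ k := by
  by_contra! hcover
  have hsub : (m : Set A) ⊆ n ∪ k := fun x hx => or_iff_not_imp_left.2 (hcover x hx)
  rcases Ideal.subset_union.1 hsub with hle | hle
  · exact hmn (hm.eq_of_le hn hle)
  · exact hmk (hm.eq_of_le hk hle)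

theorem atMostTwoMaximalIdeals {A : Type*} [CommRing A] [Nontrivial A]
    (h : ∀ P : Ideal A, P ≠ ⊤ → IsWeakly1AbsorbingPrime P) :
    ∀ m₁ m₂ m₃ : Ideal A, m₁.IsMaximal → m₂.IsMaximal → m₃.IsMaximal →
      m₁ = m₂ ∨ m₁ = m₃ ∨ m₂ = m₃ := by
  intro m₁ m₂ m₃ h₁ h₂ h₃
  by_contra! hne
  obtain ⟨h₁₂, h₁₃, h₂₃⟩ := hne
  obtain ⟨x, hx₁, hx₂, hx₃⟩ := exists_mem_notMem_of_isMaximal h₁ h₂.ne_top h₃.ne_top h₁₂ h₁₃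
  obtain ⟨z, hz₂, hz₁, hz₃⟩ :=
    exists_mem_notMem_of_isMaximal h₂ h₁.ne_top h₃.ne_top h₁₂.symm h₂₃
  have hx : ¬IsUnit x := fun hu => h₁.ne_top (Ideal.eq_top_of_isUnit_mem _ hx₁ hu)
  have hz : ¬IsUnit z := fun hu => h₂.ne_top (Ideal.eq_top_of_isUnit_mem _ hz₂ hu)
  have hxz : x * x * z ∉ m₃ := h₃.isPrime.mul_notMem (h₃.isPrime.mul_notMem hx₃ hx₃) hz₃
  have hproper : m₁ ⊓ m₂ ≠ ⊤ := ne_top_of_le_ne_top h₁.ne_top inf_le_left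
  rcases (h _ hproper).2 x x z hx hx hz (fun h0 => hxz (h0 ▸ m₃.zero_mem))
      ⟨m₁.mul_mem_right _ (m₁.mul_mem_left _ hx₁), m₂.mul_mem_left _ hz₂⟩ with hxx | hz'
  · exact h₂.isPrime.mul_notMem hx₂ hx₂ hxx.2
  · exact hz₁ hz'.1
end

section
/- Let A be a commutative ring with identity 1 ≠ 0. Then every proper ideal of A is a weakly 1-absorbing prime ideal if and only if either A is a quasi-local ring whose maximal ideal 𝔪 satisfies 𝔪³ = (0), or A is isomorphic as a ring to a product F₁ × F₂ of two fields F₁ and F₂. -/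
universe u

/-- If every proper ideal of a ring is weakly 1-absorbing prime, then an idempotent different from
`0` and `1` generates a maximal ideal. -/
theorem isMaximal_span_of_isIdempotentElem {A : Type u} [CommRing A]
    (h : ∀ P : Ideal A, P ≠ ⊤ → IsWeakly1AbsorbingPrime P) {e : A} (he : IsIdempotentElem e)
    (he0 : e ≠ 0) (he1 : e ≠ 1) : (Ideal.span {e}).IsMaximal := by
  have hee : e * e = e := he
  have hf : ¬IsUnit (1 - e) := fun hu => he0 (hu.mul_left_cancel (by linear_combination -hee))
  have heu : ¬IsUnit e := fun hu => he1 (hu.mul_left_cancel (by linear_combination hee))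
  refine Ideal.isMaximal_iff.2 ⟨fun h1 => heu ?_, fun J x hJ hx hxJ => ?_⟩
  · exact isUnit_of_dvd_one (Ideal.mem_span_singleton.1 h1)
  have heJ : e ∈ J := hJ (Ideal.mem_span_singleton_self e)
  have hxfJ : x * (1 - e) ∈ J := J.mul_mem_right _ hxJ
  by_cases hz : IsUnit (e + x * (1 - e))
  · rw [J.eq_top_of_isUnit_mem (J.add_mem heJ hxfJ) hz]
    trivial
  have hxf : x * (1 - e) ≠ 0 := fun h0 =>
    hx (Ideal.mem_span_singleton.2 ⟨x, by linear_combination h0⟩)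
  have hP : Ideal.span {x * (1 - e)} ≠ ⊤ := fun ht =>
    hf (isUnit_of_mul_isUnit_right (Ideal.span_singleton_eq_top.1 ht))
  have hprod : (1 - e) * (1 - e) * (e + x * (1 - e)) = x * (1 - e) := by
    linear_combination (e - 1 + 2 * x - e * x) * hee
  rcases (h _ hP).2 (1 - e) (1 - e) (e + x * (1 - e)) hf hf hz (by rwa [hprod])
    (by rw [hprod]; exact Ideal.mem_span_singleton_self _) with hm | hm
  · obtain ⟨r, hr⟩ := Ideal.mem_span_singleton.1 hm
    have : (1 : A) = e + x * (1 - e) * r := by linear_combination hr - hee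
    rw [this]
    exact J.add_mem heJ (J.mul_mem_right _ hxfJ)
  · obtain ⟨r, hr⟩ := Ideal.mem_span_singleton.1 hm
    exact (he0 (by linear_combination e * hr - (1 - x + x * r) * hee)).elim

/-- If every proper ideal of a ring is weakly 1-absorbing prime, then `x ^ 4 ∣ x ^ 3` for every
nonunit `x`. -/
theorem pow_four_dvd_pow_three {A : Type u} [CommRing A]
    (h : ∀ P : Ideal A, P ≠ ⊤ → IsWeakly1AbsorbingPrime P) {x : A} (hx : ¬IsUnit x) :
    x ^ 4 ∣ x ^ 3 := by
  by_cases h0 : x * x * x = 0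
  · exact ⟨0, by linear_combination h0⟩
  have hP : Ideal.span {x * x * x} ≠ ⊤ := fun ht =>
    hx (isUnit_of_mul_isUnit_right (Ideal.span_singleton_eq_top.1 ht))
  rcases (h _ hP).2 x x x hx hx hx h0 (Ideal.mem_span_singleton_self _) with hm | hm
  · obtain ⟨r, hr⟩ := Ideal.mem_span_singleton.1 hm
    exact ⟨r, by linear_combination x * hr⟩
  · obtain ⟨r, hr⟩ := Ideal.mem_span_singleton.1 hm
    exact ⟨x * r, by linear_combination x ^ 2 * hr⟩

/-- If every proper ideal of a ring that is not local is weakly 1-absorbing prime, then the ring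
has an idempotent different from `0` and `1`. -/
theorem exists_isIdempotentElem_of_not_isLocalRing {A : Type u} [CommRing A] [Nontrivial A]
    (h : ∀ P : Ideal A, P ≠ ⊤ → IsWeakly1AbsorbingPrime P) (hA : ¬IsLocalRing A) :
    ∃ e : A, IsIdempotentElem e ∧ e ≠ 0 ∧ e ≠ 1 := by
  obtain ⟨a, ha, ha'⟩ : ∃ a : A, ¬IsUnit a ∧ ¬IsUnit (1 - a) := by
    by_contra! hcon
    exact hA (IsLocalRing.of_isUnit_or_isUnit_one_sub_self fun a =>
      or_iff_not_imp_left.2 (hcon a))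
  obtain ⟨r, hr⟩ := pow_four_dvd_pow_three h ha
  have key : a ^ 3 = a ^ 3 * (a ^ 3 * r ^ 3) := by
    linear_combination (1 + a * r + a ^ 2 * r ^ 2) * hr
  refine ⟨a ^ 3 * r ^ 3, ?_, fun h0 => ha' ?_, fun h1 => ha ?_⟩
  · change a ^ 3 * r ^ 3 * (a ^ 3 * r ^ 3) = a ^ 3 * r ^ 3
    linear_combination -r ^ 3 * key
  · refine isUnit_of_dvd_one ⟨1 + a + a ^ 2, ?_⟩
    rw [h0, mul_zero] at key
    linear_combination key
  · exact isUnit_of_dvd_one ⟨a ^ 2 * r ^ 3, by linear_combination -h1⟩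

/-- In a local ring all of whose proper ideals are weakly 1-absorbing prime, the product of three
nonunits vanishes. -/
theorem mul_mul_eq_zero_of_isLocalRing {A : Type u} [CommRing A] [IsLocalRing A]
    (h : ∀ P : Ideal A, P ≠ ⊤ → IsWeakly1AbsorbingPrime P) {x y z : A}
    (hx : ¬IsUnit x) (hy : ¬IsUnit y) (hz : ¬IsUnit z) : x * y * z = 0 := by
  by_contra h0
  have unit_one_sub {t : A} (ht : ¬IsUnit t) (r : A) : IsUnit (1 - t * r) :=
    (IsLocalRing.isUnit_or_isUnit_one_sub_self _).resolve_left
      fun hu => ht (isUnit_of_mul_isUnit_left hu)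
  have hP : Ideal.span {x * y * z} ≠ ⊤ := fun ht =>
    hz (isUnit_of_mul_isUnit_right (Ideal.span_singleton_eq_top.1 ht))
  rcases (h _ hP).2 x y z hx hy hz h0 (Ideal.mem_span_singleton_self _) with hm | hm
  · obtain ⟨r, hr⟩ := Ideal.mem_span_singleton.1 hm
    have hxy : x * y = 0 :=
      (unit_one_sub hz r).mul_left_cancel (by linear_combination hr)
    exact h0 (by rw [hxy, zero_mul])
  · obtain ⟨r, hr⟩ := Ideal.mem_span_singleton.1 hm
    have hz0 : z = 0 :=
      (unit_one_sub hx (y * r)).mul_left_cancel (by linear_combination hr)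
    exact h0 (by rw [hz0, mul_zero])

/-- A ring with an idempotent `e` such that `e` and `1 - e` generate maximal ideals is a product
of two fields. -/
theorem exists_ringEquiv_prod_of_isIdempotentElem {A : Type u} [CommRing A] {e : A}
    (he : IsIdempotentElem e) (h₁ : (Ideal.span {e}).IsMaximal)
    (h₂ : (Ideal.span {1 - e}).IsMaximal) :
    ∃ (F₁ F₂ : Type u) (_ : Field F₁) (_ : Field F₂), Nonempty (A ≃+* (F₁ × F₂)) := by
  have hcop : IsCoprime (Ideal.span {e}) (Ideal.span {1 - e}) := by
    rw [Ideal.isCoprime_span_singleton_iff]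
    exact ⟨1, 1, by ring⟩
  have hinf : Ideal.span {e} ⊓ Ideal.span {1 - e} = ⊥ := by
    rw [← Ideal.mul_eq_inf_of_coprime hcop.sup_eq, Ideal.span_singleton_mul_span_singleton,
      he.mul_one_sub_self, Ideal.span_singleton_zero]
  exact ⟨A ⧸ Ideal.span {e}, A ⧸ Ideal.span {1 - e}, Ideal.Quotient.field _,
    Ideal.Quotient.field _, ⟨(RingEquiv.quotientBot A).symm.trans <|
      (Ideal.quotEquivOfEq hinf.symm).trans (Ideal.quotientInfEquivQuotientProd _ _ hcop)⟩⟩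

/-- In a product of two fields, if `x * y * z ≠ 0` with `y` and `z` nonunits, then `x * y` is a
multiple of `x * y * z`. -/
theorem mul_mul_dvd_mul_of_prod_field {F₁ F₂ : Type*} [Field F₁] [Field F₂] {x y z : F₁ × F₂}
    (hy : ¬IsUnit y) (hz : ¬IsUnit z) (h0 : x * y * z ≠ 0) : x * y * z ∣ x * y := by
  refine ⟨(z.1⁻¹, z.2⁻¹), ?_⟩
  obtain ⟨x₁, x₂⟩ := x
  obtain ⟨y₁, y₂⟩ := y
  obtain ⟨z₁, z₂⟩ := z
  simp only [Prod.isUnit_iff, isUnit_iff_ne_zero, ne_eq, Prod.mk_mul_mk, Prod.mk_eq_zero,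
    mul_eq_zero, Prod.mk.injEq] at *
  by_cases hz₁ : z₁ = 0
  · have hz₂ : z₂ ≠ 0 := by tauto
    have hy₁ : y₁ = 0 := by tauto
    simp [hy₁, hz₂]
  · have hz₂ : z₂ = 0 := by tauto
    have hy₂ : y₂ = 0 := by tauto
    simp [hy₂, hz₁]

theorem forall_isWeakly1AbsorbingPrime_iff {A : Type u} [CommRing A] [Nontrivial A] :
    (∀ P : Ideal A, P ≠ ⊤ → IsWeakly1AbsorbingPrime P) ↔
      ((IsLocalRing A ∧ ∀ m : Ideal A, m.IsMaximal → m ^ 3 = ⊥) ∨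
       (∃ (F₁ F₂ : Type u) (_ : Field F₁) (_ : Field F₂), Nonempty (A ≃+* (F₁ × F₂)))) := by
  constructor
  · intro h
    by_cases hA : IsLocalRing A
    · refine Or.inl ⟨hA, fun m hm => ?_⟩
      have hnu {x : A} (hx : x ∈ m) : ¬IsUnit x := fun hu =>
        hm.ne_top (m.eq_top_of_isUnit_mem hx hu)
      rw [pow_succ, pow_two, eq_bot_iff, Ideal.mul_le]
      intro w hw z hz
      induction hw using Submodule.mul_induction_on' with
      | mem_mul_mem x hx y hy =>
        exact mul_mul_eq_zero_of_isLocalRing h (hnu hx) (hnu hy) (hnu hz)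
      | add a _ b _ ha hb => rw [add_mul]; exact add_mem ha hb
    · obtain ⟨e, he, he0, he1⟩ := exists_isIdempotentElem_of_not_isLocalRing h hA
      exact Or.inr (exists_ringEquiv_prod_of_isIdempotentElem he
        (isMaximal_span_of_isIdempotentElem h he he0 he1)
        (isMaximal_span_of_isIdempotentElem h he.one_sub (sub_ne_zero.2 he1.symm)
          (by simpa using he0)))
  · rintro (⟨hA, hm⟩ | ⟨F₁, F₂, _, _, ⟨φ⟩⟩) P hP
    · refine ⟨hP, fun x y z hx hy hz h0 _ => (h0 ?_).elim⟩
      rw [← Ideal.mem_bot, ← hm _ (IsLocalRing.maximalIdeal.isMaximal A), pow_succ, pow_two]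
      exact Ideal.mul_mem_mul (Ideal.mul_mem_mul hx hy) hz
    · refine ⟨hP, fun x y z _ hy hz h0 hmem => Or.inl (P.mem_of_dvd ?_ hmem)⟩
      rw [← map_dvd_iff φ]
      simp only [map_mul]
      refine mul_mul_dvd_mul_of_prod_field (by simpa using hy) (by simpa using hz) ?_
      simpa only [← map_mul, ne_eq, map_eq_zero_iff φ φ.injective] using h0
end

section
/- Let X be a completely regular topological space and let C(X) denote the commutative ring of continuous real-valued functions on X. Let P be a proper z-ideal of C(X). Then the following are equivalent: (1) P is a weakly 1-absorbing prime ideal of C(X); (2) P is a weakly prime ideal of C(X); (3) P = (0) or P is a prime ideal of C(X). -/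
/-- In a reduced ring, a weakly 1-absorbing prime radical ideal is weakly prime. -/
theorem IsWeakly1AbsorbingPrime.isWeaklyPrime {A : Type*} [CommRing A] [IsReduced A]
    {P : Ideal A} (h : IsWeakly1AbsorbingPrime P) (hrad : ∀ x, x * x ∈ P → x ∈ P) :
    IsWeaklyPrime P := by
  refine ⟨h.1, fun x y hne hmem => ?_⟩
  by_cases hx : IsUnit x
  · exact Or.inr ((P.unit_mul_mem_iff_mem hx).1 hmem)
  by_cases hy : IsUnit y
  · exact Or.inl ((P.mul_unit_mem_iff_mem hy).1 hmem)
  have hne' : x * x * y ≠ 0 := fun h0 => hne <| pow_eq_zero_iff two_ne_zero |>.1 <| by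
    linear_combination y * h0
  have hmem' : x * x * y ∈ P := by
    rw [mul_assoc]
    exact P.mul_mem_left x hmem
  exact (h.2 x x y hx hx hy hne' hmem').imp_left (hrad x)

/-- In a reduced ring, a nonzero weakly prime ideal is prime. -/
theorem IsWeaklyPrime.eq_bot_or_isPrime {A : Type*} [CommRing A] [IsReduced A] {P : Ideal A}
    (h : IsWeaklyPrime P) : P = ⊥ ∨ P.IsPrime := by
  refine or_iff_not_imp_left.2 fun hbot => ⟨h.1, fun {x y} hxy => ?_⟩
  by_contra! hcon
  obtain ⟨hx, hy⟩ := hcon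
  have hxy0 : x * y = 0 := by
    by_contra hne
    exact (h.2 x y hne hxy).elim hx hy
  obtain ⟨p, hp, hp0⟩ := Submodule.exists_mem_ne_zero_of_ne_bot hbot
  have hxp : x + p ∉ P := fun hmem => hx ((P.add_mem_iff_left hp).1 hmem)
  have hyp : y + p ∉ P := fun hmem => hy ((P.add_mem_iff_left hp).1 hmem)
  have hx0 : x * p = 0 := by
    by_contra hne
    have heq : x * (y + p) = x * p := by linear_combination hxy0
    exact (h.2 x (y + p) (heq ▸ hne) (heq ▸ P.mul_mem_left x hp)).elim hx hyp
  have hy0 : y * p = 0 := by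
    by_contra hne
    have heq : (x + p) * y = y * p := by linear_combination hxy0
    exact (h.2 (x + p) y (heq ▸ hne) (heq ▸ P.mul_mem_left y hp)).elim hxp hy
  have heq : (x + p) * (y + p) = p * p := by linear_combination hxy0 + hx0 + hy0
  have hpp : p * p ≠ 0 := fun h0 => hp0 (pow_eq_zero_iff two_ne_zero |>.1 (by rw [sq, h0]))
  exact (h.2 _ _ (heq ▸ hpp) (heq ▸ P.mul_mem_left p hp)).elim hxp hyp

theorem isWeaklyPrime_bot {A : Type*} [CommRing A] [Nontrivial A] :
    IsWeaklyPrime (⊥ : Ideal A) :=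
  ⟨bot_ne_top, fun _ _ hne hmem => absurd (Ideal.mem_bot.1 hmem) hne⟩

theorem Ideal.IsPrime.isWeaklyPrime {A : Type*} [CommRing A] {P : Ideal A} (h : P.IsPrime) :
    IsWeaklyPrime P :=
  ⟨h.ne_top, fun _ _ _ hmem => h.mem_or_mem hmem⟩

theorem ContinuousMap.isReduced_real {X : Type*} [TopologicalSpace X] : IsReduced C(X, ℝ) :=
  ⟨fun f ⟨n, hn⟩ => ContinuousMap.ext fun x => eq_zero_of_pow_eq_zero (n := n) <| by
    simpa using DFunLike.congr_fun hn x⟩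

theorem continuousMap_zIdeal_isWeakly1AbsorbingPrime_iff {X : Type*} [TopologicalSpace X]
    [CompletelyRegularSpace X] [Nonempty X] (P : Ideal C(X, ℝ)) (hP : P ≠ ⊤)
    (hz : ∀ f g : C(X, ℝ), g ∈ P → {x | f x = 0} = {x | g x = 0} → f ∈ P) :
    (IsWeakly1AbsorbingPrime P ↔ IsWeaklyPrime P) ∧
    (IsWeaklyPrime P ↔ (P = ⊥ ∨ P.IsPrime)) := by
  have := ContinuousMap.isReduced_real (X := X)
  have hrad : ∀ f : C(X, ℝ), f * f ∈ P → f ∈ P := fun f hf => hz f (f * f) hf (by simp)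
  refine ⟨⟨fun h => h.isWeaklyPrime hrad, fun h => h.isWeakly1AbsorbingPrime⟩,
    fun h => h.eq_bot_or_isPrime, ?_⟩
  rintro (rfl | h)
  · exact isWeaklyPrime_bot
  · exact h.isWeaklyPrime
end
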